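/- arXiv:2507.10108 — 2 statements merged into one kernel-verified Lean document; each statement's English description precedes it below -/
import Mathlib

section
/- Invariance criterion via generators: let k ≥ 2 and let u ∈ (P_k)_d be homogeneous of degree d. Then ψ_g(u) + u ∈ A⁺P_k for every g ∈ GL_k(F₂) if and only if ρ_j(u) + u ∈ A⁺P_k for every j ∈ {1, …, k}. -/
open MvPolynomial

noncomputable section

abbrev P (k : ℕ) := MvPolynomial (Fin k) (ZMod 2)

/-- The total Steenrod square: the `F₂`-algebra endomorphism of `P k` with
`Sq(xᵢ) = xᵢ + xᵢ²`. -/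
def SqTotal (k : ℕ) : P k →ₐ[ZMod 2] P k :=
  aeval (fun i => X i + X i ^ 2)

/-- The `n`-th Steenrod square: on a homogeneous polynomial of degree `d` it is the
degree-`(d+n)` homogeneous component of the total square, extended by linearity over
homogeneous components. -/
def Sq (k n : ℕ) (f : P k) : P k :=
  ∑ d ∈ Finset.range (f.totalDegree + 1),
    homogeneousComponent (d + n) (SqTotal k (homogeneousComponent d f))

abbrev homSub (k d : ℕ) : Submodule (ZMod 2) (P k) :=
  homogeneousSubmodule (Fin k) (ZMod 2) d

/-- The hit submodule `A⁺P_k = Σ_{n ≥ 1} Sq^n(P_k)`. -/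
def hit (k : ℕ) : Submodule (ZMod 2) (P k) :=
  Submodule.span (ZMod 2) {f : P k | ∃ n : ℕ, 1 ≤ n ∧ ∃ g : P k, f = Sq k n g}

/-- `(QP_k)_d = (P_k)_d / (A⁺P_k ∩ (P_k)_d)`. -/
abbrev QP (k d : ℕ) :=
  ↥(homSub k d) ⧸ (hit k).comap (homSub k d).subtype

/-- The algebra endomorphism of `P k` given by the linear substitution `x_i ↦ Σ_j C_{ij} x_j`. -/
def psi (k : ℕ) (C : Matrix (Fin k) (Fin k) (ZMod 2)) : P k →ₐ[ZMod 2] P k :=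
  aeval (fun i => ∑ j, C i j • X j)

/-- The generators `ρ_j` of `GL_k(F₂)` acting on `P k` (0-indexed: for `j + 1 < k` the
transposition of `x_{j+1}` and `x_{j+2}` in 1-indexed notation, i.e. of the variables with
indices `j` and `j+1`; for `j = k - 1` the transvection `x_k ↦ x_k + x_{k-1}`). -/
def rho (k : ℕ) (j : ℕ) : P k →ₐ[ZMod 2] P k :=
  if h : j + 1 < k then
    aeval (fun i => X (Equiv.swap (⟨j, by omega⟩ : Fin k) (⟨j + 1, h⟩ : Fin k) i))
  else if h2 : 2 ≤ k then
    aeval (fun i : Fin k =>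
      if i = (⟨k - 1, by omega⟩ : Fin k) then X i + X (⟨k - 2, by omega⟩ : Fin k)
      else X i)
  else
    aeval X

theorem psi_X (k : ℕ) (C : Matrix (Fin k) (Fin k) (ZMod 2)) (i : Fin k) :
    psi k C (X i) = ∑ j, C i j • X j := by
  simp [psi]

theorem psi_one (k : ℕ) : psi k 1 = AlgHom.id (ZMod 2) (P k) := by
  ext1 i
  simp [psi_X, Matrix.one_apply]

theorem psi_mul (k : ℕ) (A B : Matrix (Fin k) (Fin k) (ZMod 2)) :
    psi k (A * B) = (psi k B).comp (psi k A) := by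
  ext1 i
  simp only [psi_X, AlgHom.comp_apply, map_sum, map_smul, Matrix.mul_apply, Finset.sum_smul,
    Finset.smul_sum, mul_smul]
  exact Finset.sum_comm

theorem psi_isHomogeneous {k d : ℕ} (C : Matrix (Fin k) (Fin k) (ZMod 2)) {f : P k}
    (hf : f.IsHomogeneous d) : (psi k C f).IsHomogeneous d := by
  have h := hf.aeval (fun i => ∑ j, C i j • (X j : P k)) (n := 1) fun i =>
    IsHomogeneous.sum _ _ _ fun j _ => (homSub k 1).smul_mem _ (isHomogeneous_X _ j)
  rwa [one_mul] at h

theorem psi_homogeneousComponent {k : ℕ} (C : Matrix (Fin k) (Fin k) (ZMod 2)) (n : ℕ) (f : P k) :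
    psi k C (homogeneousComponent n f) = homogeneousComponent n (psi k C f) := by
  conv_rhs => rw [← sum_homogeneousComponent f]
  simp only [map_sum]
  rw [Finset.sum_congr rfl fun i _ => homogeneousComponent_of_mem
    (psi_isHomogeneous C (homogeneousComponent_isHomogeneous i f))]
  rw [Finset.sum_ite_eq]
  split_ifs with h
  · rfl
  · rw [homogeneousComponent_eq_zero n f (by simpa using h), map_zero]

theorem psi_SqTotal {k : ℕ} (C : Matrix (Fin k) (Fin k) (ZMod 2)) (f : P k) :
    psi k C (SqTotal k f) = SqTotal k (psi k C f) := by
  have h : (psi k C).comp (SqTotal k) = (SqTotal k).comp (psi k C) := by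
    ext1 i
    have hc : ∀ c : ZMod 2, c ^ 2 = c := by decide
    simp [SqTotal, psi_X, CharTwo.sum_sq, smul_pow, hc, Finset.sum_add_distrib]
  exact DFunLike.congr_fun h f

theorem Sq_of_isHomogeneous {k d : ℕ} (n : ℕ) {f : P k} (hf : f.IsHomogeneous d) :
    Sq k n f = homogeneousComponent (d + n) (SqTotal k f) := by
  rcases eq_or_ne f 0 with rfl | h0
  · simp [Sq]
  · unfold Sq
    rw [Finset.sum_eq_single d]
    · rw [homogeneousComponent_eq_self hf]
    · intro e _ hed
      rw [homogeneousComponent_of_mem hf, if_neg hed, map_zero, map_zero]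
    · simp [hf.totalDegree h0]

theorem psi_mem_hit {k : ℕ} (C : Matrix (Fin k) (Fin k) (ZMod 2)) {f : P k} (hf : f ∈ hit k) :
    psi k C f ∈ hit k := by
  suffices hit k ≤ (hit k).comap (psi k C).toLinearMap from this hf
  refine Submodule.span_le.mpr ?_
  rintro _ ⟨n, hn, g, rfl⟩
  change psi k C (Sq k n g) ∈ hit k
  rw [Sq, map_sum]
  refine Submodule.sum_mem _ fun d _ => Submodule.subset_span
    ⟨n, hn, psi k C (homogeneousComponent d g), ?_⟩
  rw [psi_homogeneousComponent, psi_SqTotal,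
    Sq_of_isHomogeneous n (psi_isHomogeneous C (homogeneousComponent_isHomogeneous d g))]

/-- The matrices whose linear substitution fixes `u` modulo hit polynomials. -/
def hitStabilizer (k : ℕ) (u : P k) : Submonoid (Matrix (Fin k) (Fin k) (ZMod 2)) where
  carrier := {C | psi k C u + u ∈ hit k}
  one_mem' := by simp [psi_one, CharTwo.add_self_eq_zero]
  mul_mem' {A B} hA hB := by
    have h := (hit k).add_mem (psi_mem_hit B hA) hB
    rw [map_add, add_assoc, ← add_assoc (psi k B u), CharTwo.add_self_eq_zero, zero_add] at h
    simpa [psi_mul] using h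

theorem mem_hitStabilizer {k : ℕ} {u : P k} {C : Matrix (Fin k) (Fin k) (ZMod 2)} :
    C ∈ hitStabilizer k u ↔ psi k C u + u ∈ hit k :=
  Iff.rfl

theorem psi_permMatrix (k : ℕ) (σ : Equiv.Perm (Fin k)) :
    psi k (σ.permMatrix (ZMod 2)) = aeval fun i => X (σ i) := by
  ext1 i
  simp [psi_X, PEquiv.toMatrix_apply]

theorem rho_eq_psi_permMatrix {n : ℕ} (i : Fin (n + 1)) :
    rho (n + 2) i = psi (n + 2) ((Equiv.swap i.castSucc i.succ).permMatrix (ZMod 2)) := by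
  rw [psi_permMatrix, rho, dif_pos (by omega)]
  rfl

theorem rho_last_eq_psi_transvection (n : ℕ) :
    rho (n + 2) (n + 1) =
      psi (n + 2) (Matrix.transvection (Fin.last (n + 1)) (Fin.last n).castSucc 1) := by
  rw [rho, dif_neg (by omega), dif_pos (by omega)]
  ext1 i
  have h₁ : (⟨n + 2 - 1, by omega⟩ : Fin (n + 2)) = Fin.last (n + 1) := rfl
  have h₂ : (⟨n + 2 - 2, by omega⟩ : Fin (n + 2)) = (Fin.last n).castSucc := rfl
  simp only [h₁, h₂, aeval_X, psi_X, Matrix.transvection, Matrix.add_apply, Matrix.one_apply,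
    Matrix.single_apply, add_smul, Finset.sum_add_distrib, ite_smul, one_smul, zero_smul,
    Finset.sum_ite_eq, Finset.mem_univ, if_true]
  split_ifs with h
  · simp [h]
  · simp [Ne.symm h]

theorem permMatrix_mul_transvection_mul_permMatrix {m R : Type*} [Fintype m] [DecidableEq m]
    [CommRing R] (σ : Equiv.Perm m) (a b : m) (c : R) :
    (σ⁻¹).permMatrix R * Matrix.transvection a b c * σ.permMatrix R =
      Matrix.transvection (σ a) (σ b) c := by
  rw [Equiv.Perm.permMatrix, Equiv.Perm.permMatrix, PEquiv.toMatrix_toPEquiv_mul,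
    PEquiv.mul_toMatrix_toPEquiv]
  ext i j
  simp [Matrix.transvection, Matrix.one_apply, Matrix.single_apply, Equiv.eq_symm_apply]

theorem exists_perm_apply_eq_and_apply_eq {α : Type*} [DecidableEq α] {a b i j : α}
    (hab : a ≠ b) (hij : i ≠ j) : ∃ σ : Equiv.Perm α, σ a = i ∧ σ b = j := by
  refine ⟨Equiv.swap (Equiv.swap a i b) j * Equiv.swap a i, ?_, ?_⟩
  · have h : i ≠ Equiv.swap a i b := fun h => hab <| (Equiv.swap a i).injective <| by simpa using h
    simp [Equiv.swap_apply_of_ne_of_ne h hij]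
  · simp

theorem permMatrix_mem_of_swap_mem {n : ℕ} {R : Type*} [CommRing R]
    {S : Submonoid (Matrix (Fin (n + 1)) (Fin (n + 1)) R)}
    (h : ∀ i : Fin n, (Equiv.swap i.castSucc i.succ).permMatrix R ∈ S)
    (σ : Equiv.Perm (Fin (n + 1))) : σ.permMatrix R ∈ S := by
  have hσ : σ ∈ Submonoid.closure
      (Set.range fun i : Fin n => Equiv.swap i.castSucc i.succ) := by
    rw [Equiv.Perm.mclosure_swap_castSucc_succ]
    trivial
  induction hσ using Submonoid.closure_induction with
  | mem x hx => obtain ⟨i, rfl⟩ := hx; exact h i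
  | one => rw [Matrix.permMatrix_one]; exact S.one_mem
  | mul x y _ _ hx hy => rw [Matrix.permMatrix_mul]; exact S.mul_mem hy hx

/-- Adjacent transpositions and a single transvection generate all invertible matrices
over `F₂`. -/
theorem mem_of_swap_mem_of_transvection_mem {n : ℕ}
    {S : Submonoid (Matrix (Fin (n + 1)) (Fin (n + 1)) (ZMod 2))}
    (hswap : ∀ i : Fin n, (Equiv.swap i.castSucc i.succ).permMatrix (ZMod 2) ∈ S)
    {a b : Fin (n + 1)} (hab : a ≠ b) (htrans : Matrix.transvection a b 1 ∈ S)
    {M : Matrix (Fin (n + 1)) (Fin (n + 1)) (ZMod 2)} (hM : M.det ≠ 0) : M ∈ S := by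
  have h01 : ∀ c : ZMod 2, c ≠ 0 → c = 1 := by decide
  refine Matrix.diagonal_transvection_induction_of_det_ne_zero (· ∈ S) M hM ?_ ?_ ?_
  · intro D hD
    have hD1 : D = fun _ => 1 := funext fun i => h01 _ <| by
      rw [Matrix.det_diagonal] at hD
      exact Finset.prod_ne_zero_iff.mp hD i (Finset.mem_univ i)
    subst hD1
    rw [Matrix.diagonal_one]
    exact S.one_mem
  · rintro ⟨i, j, hij, c⟩
    obtain ⟨σ, rfl, rfl⟩ := exists_perm_apply_eq_and_apply_eq hab hij
    rw [Matrix.TransvectionStruct.toMatrix_mk]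
    by_cases hc : c = 0
    · rw [hc, Matrix.transvection_zero]
      exact S.one_mem
    · rw [h01 c hc, ← permMatrix_mul_transvection_mul_permMatrix]
      exact S.mul_mem (S.mul_mem (permMatrix_mem_of_swap_mem hswap _) htrans)
        (permMatrix_mem_of_swap_mem hswap _)
  · exact fun A B _ _ hA hB => S.mul_mem hA hB

/-- Invariance criterion via generators: a homogeneous `u` satisfies
`ψ_g(u) + u ∈ A⁺P_k` for every `g ∈ GL_k(F₂)` iff `ρ_j(u) + u ∈ A⁺P_k` for the `k`
generators `ρ_1, …, ρ_k` (0-indexed here as `rho k j` for `j < k`). -/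
theorem invariance_criterion (k d : ℕ) (hk : 2 ≤ k) (u : P k) (hu : u ∈ homSub k d) :
    (∀ g : Matrix.GeneralLinearGroup (Fin k) (ZMod 2),
        psi k (g : Matrix (Fin k) (Fin k) (ZMod 2)) u + u ∈ hit k) ↔
      (∀ j : ℕ, j < k → rho k j u + u ∈ hit k) := by
  obtain ⟨n, rfl⟩ := Nat.exists_eq_add_of_le' hk
  constructor
  · intro h
    have hdet : ∀ M : Matrix (Fin (n + 2)) (Fin (n + 2)) (ZMod 2), M.det ≠ 0 →
        psi (n + 2) M u + u ∈ hit (n + 2) := fun M hM =>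
      h (Matrix.GeneralLinearGroup.mkOfDetNeZero M hM)
    intro j hj
    rcases Nat.lt_succ_iff_lt_or_eq.mp hj with hj | rfl
    · rw [rho_eq_psi_permMatrix ⟨j, hj⟩]
      exact hdet _ (by simp [Matrix.det_permutation])
    · rw [rho_last_eq_psi_transvection]
      exact hdet _ (by
        rw [Matrix.det_transvection_of_ne _ _ (Fin.castSucc_lt_last _).ne']
        exact one_ne_zero)
  · intro h g
    refine mem_hitStabilizer.mp <| mem_of_swap_mem_of_transvection_mem
      (a := Fin.last (n + 1)) (b := (Fin.last n).castSucc) ?_ (Fin.castSucc_lt_last _).ne' ?_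
      g.det_ne_zero
    · intro i
      rw [mem_hitStabilizer, ← rho_eq_psi_permMatrix]
      exact h i (by omega)
    · rw [mem_hitStabilizer, ← rho_last_eq_psi_transvection]
      exact h (n + 1) (by omega)
end
end

section
/- Primitivity of the preimage of p₀: let S be the following set of 62 exponent quadruples (a,b,c,d), each with a+b+c+d = 33: (7,7,5,14), (7,9,3,14), (11,5,3,14), (13,3,3,14), (7,7,6,13), (7,10,3,13), (11,6,3,13), (14,3,3,13), (7,9,6,11), (11,5,6,11), (13,3,6,11), (7,10,5,11), (11,6,5,11), (14,3,5,11), (7,7,9,10), (7,9,7,10), (11,5,7,10), (13,3,7,10), (7,11,5,10), (7,13,3,10), (7,7,10,9), (7,10,7,9), (11,6,7,9), (14,3,7,9), (7,11,6,9), (7,14,3,9), (7,9,10,7), (11,5,10,7), (13,3,10,7), (7,10,9,7), (11,6,9,7), (14,3,9,7), (7,13,6,7), (7,14,5,7), (7,7,13,6), (7,9,11,6), (11,5,11,6), (13,3,11,6), (11,7,9,6), (13,7,7,6), (11,11,5,6), (11,13,3,6), (7,7,14,5), (7,10,11,5), (11,6,11,5), (14,3,11,5), (11,7,10,5), (14,7,7,5),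 (11,11,6,5), (11,14,3,5), (7,9,14,3), (11,5,14,3), (13,3,14,3), (7,10,13,3), (11,6,13,3), (14,3,13,3), (13,7,10,3), (14,7,9,3), (13,11,6,3), (14,11,5,3), (13,14,3,3), (14,13,3,3). Let λ : (P_4)_{33} → F₂ be the F₂-linear functional with λ(x_1^{a}x_2^{b}x_3^{c}x_4^{d}) = 1 if (a,b,c,d) ∈ S and λ(m) = 0 for every other monomial m of degree 33. Then λ vanishes on A⁺P_4 ∩ (P_4)_{33}; equivalently, λ(Sq^i(g)) = 0 for every i ≥ 1 and every homogeneous g ∈ P_4 of degree 33 − i. (This expresses that the explicit 62-term element x of the dual divided power algebra constructed as a preimage of the class p₀ is annihilated by all positive-degree Steenrod operations.) -/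
open MvPolynomial

noncomputable section

/-- Exponent vector `(a, b, c, d)` in four variables. -/
def e4 (q : ℕ × ℕ × ℕ × ℕ) : Fin 4 →₀ ℕ :=
  Finsupp.single 0 q.1 + Finsupp.single 1 q.2.1 +
    Finsupp.single 2 q.2.2.1 + Finsupp.single 3 q.2.2.2

/-- The 62 exponent quadruples of the preimage of `p₀`. -/
def S19 : Finset (ℕ × ℕ × ℕ × ℕ) :=
  {(7,7,5,14), (7,9,3,14), (11,5,3,14), (13,3,3,14), (7,7,6,13), (7,10,3,13),
   (11,6,3,13), (14,3,3,13), (7,9,6,11), (11,5,6,11), (13,3,6,11), (7,10,5,11),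
   (11,6,5,11), (14,3,5,11), (7,7,9,10), (7,9,7,10), (11,5,7,10), (13,3,7,10),
   (7,11,5,10), (7,13,3,10), (7,7,10,9), (7,10,7,9), (11,6,7,9), (14,3,7,9),
   (7,11,6,9), (7,14,3,9), (7,9,10,7), (11,5,10,7), (13,3,10,7), (7,10,9,7),
   (11,6,9,7), (14,3,9,7), (7,13,6,7), (7,14,5,7), (7,7,13,6), (7,9,11,6),
   (11,5,11,6), (13,3,11,6), (11,7,9,6), (13,7,7,6), (11,11,5,6), (11,13,3,6),
   (7,7,14,5), (7,10,11,5), (11,6,11,5), (14,3,11,5), (11,7,10,5), (14,7,7,5),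
   (11,11,6,5), (11,14,3,5), (7,9,14,3), (11,5,14,3), (13,3,14,3), (7,10,13,3),
   (11,6,13,3), (14,3,13,3), (13,7,10,3), (14,7,9,3), (13,11,6,3), (14,11,5,3),
   (13,14,3,3), (14,13,3,3)}

/-- The linear functional on `P_4` taking value 1 exactly on the monomials with exponent
vector in `S19` (among the degree-33 monomials). -/
def lam4 : P 4 →ₗ[ZMod 2] ZMod 2 where
  toFun f := ∑ q ∈ S19, coeff (e4 q) f
  map_add' := by
    intro f g
    simp [coeff_add, Finset.sum_add_distrib]
  map_smul' := by
    intro c f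
    simp [coeff_smul, Finset.mul_sum, smul_eq_mul]

/-- The exponent quadruples of `S19`, as a list. -/
def quadruples : List (ℕ × ℕ × ℕ × ℕ) :=
  [(7,7,5,14), (7,9,3,14), (11,5,3,14), (13,3,3,14), (7,7,6,13), (7,10,3,13),
   (11,6,3,13), (14,3,3,13), (7,9,6,11), (11,5,6,11), (13,3,6,11), (7,10,5,11),
   (11,6,5,11), (14,3,5,11), (7,7,9,10), (7,9,7,10), (11,5,7,10), (13,3,7,10),
   (7,11,5,10), (7,13,3,10), (7,7,10,9), (7,10,7,9), (11,6,7,9), (14,3,7,9),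
   (7,11,6,9), (7,14,3,9), (7,9,10,7), (11,5,10,7), (13,3,10,7), (7,10,9,7),
   (11,6,9,7), (14,3,9,7), (7,13,6,7), (7,14,5,7), (7,7,13,6), (7,9,11,6),
   (11,5,11,6), (13,3,11,6), (11,7,9,6), (13,7,7,6), (11,11,5,6), (11,13,3,6),
   (7,7,14,5), (7,10,11,5), (11,6,11,5), (14,3,11,5), (11,7,10,5), (14,7,7,5),
   (11,11,6,5), (11,14,3,5), (7,9,14,3), (11,5,14,3), (13,3,14,3), (7,10,13,3),
   (11,6,13,3), (14,3,13,3), (13,7,10,3), (14,7,9,3), (13,11,6,3), (14,11,5,3),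
   (13,14,3,3), (14,13,3,3)]

theorem S19_val : S19.val = (quadruples : Multiset (ℕ × ℕ × ℕ × ℕ)) := by
  decide +kernel

/-- The coefficient of `x ^ j` in `(x + x ^ 2) ^ m` is odd. -/
def oddCoeff (m j : ℕ) : Bool :=
  Nat.ble m j && Nat.beq (Nat.land (j - m) m) (j - m)

/-- The coefficient of `x ^ j` in `(x + x ^ 2) ^ m`. -/
def sqCoeff (m j : ℕ) : ZMod 2 :=
  if m ≤ j then (m.choose (j - m) : ZMod 2) else 0

theorem sqCoeff_eq_ite {m j : ℕ} (hm : m < 15) (hj : j < 15) :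
    sqCoeff m j = if oddCoeff m j then 1 else 0 := by
  have h : ∀ m < 15, ∀ j < 15, sqCoeff m j = if oddCoeff m j then 1 else 0 := by
    unfold sqCoeff
    decide +kernel
  exact h m hm j hj

theorem sqCoeff_eq_zero_of_lt {m j : ℕ} (h : j < m) : sqCoeff m j = 0 :=
  if_neg (by lia)

/-- Over the exponent vectors `(m₀, m₁, m₂, m₃)` of degree below 33, the number of quadruples
whose monomial occurs in `Sq(x ^ m)` is even. -/
def evenIncidence : Bool :=
  (List.range 15).all fun m₀ =>
    let l₀ := quadruples.filter fun q => oddCoeff m₀ q.1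
    (List.range 15).all fun m₁ =>
      let l₁ := l₀.filter fun q => oddCoeff m₁ q.2.1
      (List.range 15).all fun m₂ =>
        let l₂ := l₁.filter fun q => oddCoeff m₂ q.2.2.1
        l₂.isEmpty || (List.range 15).all fun m₃ =>
          Nat.ble 33 (m₀ + m₁ + m₂ + m₃) ||
            Nat.beq ((l₂.filter fun q => oddCoeff m₃ q.2.2.2).length % 2) 0

theorem evenIncidence_eq_true : evenIncidence = true := by
  decide +kernel

theorem X_add_X_sq_pow {σ : Type*} (i : σ) (m : ℕ) :
    (X i + X i ^ 2 : MvPolynomial σ (ZMod 2)) ^ m =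
      ∑ j ∈ Finset.range (2 * m + 1), monomial (Finsupp.single i j) (sqCoeff m j) := by
  have h : (X i + X i ^ 2 : MvPolynomial σ (ZMod 2)) ^ m =
      ∑ j ∈ Finset.range (m + 1), monomial (Finsupp.single i (m + j)) (m.choose j : ZMod 2) := by
    rw [show (X i + X i ^ 2 : MvPolynomial σ (ZMod 2)) = X i * (X i + 1) by ring, mul_pow, add_pow,
      Finset.mul_sum]
    refine Finset.sum_congr rfl fun j _ => ?_
    rw [one_pow, mul_one, ← mul_assoc, ← pow_add, X_pow_eq_monomial, mul_comm, ← map_natCast C,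
      C_mul_monomial, mul_one]
  have h₀ : ∑ j ∈ Finset.range m, monomial (Finsupp.single i j) (sqCoeff m j) = 0 := by
    refine Finset.sum_eq_zero fun j hj => ?_
    rw [sqCoeff_eq_zero_of_lt (Finset.mem_range.mp hj), map_zero]
  rw [h, show 2 * m + 1 = m + (m + 1) by ring, Finset.sum_range_add _ m (m + 1), h₀, zero_add]
  exact Finset.sum_congr rfl fun j _ => by
    rw [sqCoeff, if_pos (Nat.le_add_right m j), Nat.add_sub_cancel_left]

theorem coeff_SqTotal_monomial {k : ℕ} (m e : Fin k →₀ ℕ) :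
    coeff e (SqTotal k (monomial m 1)) = ∏ i, sqCoeff (m i) (e i) := by
  have he' : Finsupp.equivFunOnFinite.symm (⇑e) = e := Finsupp.ext fun _ => rfl
  have hterm (p : Fin k → ℕ) :
      ∏ i, monomial (Finsupp.single i (p i)) (sqCoeff (m i) (p i)) =
        monomial (Finsupp.equivFunOnFinite.symm p) (∏ i, sqCoeff (m i) (p i)) := by
    rw [← Finsupp.univ_sum_single (Finsupp.equivFunOnFinite.symm p), monomial_sum_prod]
    rfl
  rw [SqTotal, aeval_monomial, map_one, one_mul, Finsupp.prod_fintype _ _ fun i => pow_zero _]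
  simp_rw [X_add_X_sq_pow, Finset.prod_univ_sum, hterm, coeff_sum, coeff_monomial]
  rw [Finset.sum_eq_single (⇑e)]
  · rw [if_pos he']
  · intro p _ hp
    exact if_neg fun h => hp (by rw [← h]; rfl)
  · intro he
    rw [if_pos he']
    obtain ⟨i, hi⟩ : ∃ i, 2 * m i + 1 ≤ e i := by simpa [Fintype.mem_piFinset] using he
    refine Finset.prod_eq_zero (Finset.mem_univ i) ?_
    rw [sqCoeff, if_pos (by lia), Nat.choose_eq_zero_of_lt (by lia), Nat.cast_zero]

theorem sum_prod_sqCoeff_eq_zero (m : Fin 4 →₀ ℕ) (hm : m.degree < 33) :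
    ∑ q ∈ S19, ∏ i, sqCoeff (m i) (e4 q i) = 0 := by
  have hS : ∀ q ∈ S19, q.1 < 15 ∧ q.2.1 < 15 ∧ q.2.2.1 < 15 ∧ q.2.2.2 < 15 := by
    decide +kernel
  have he (q : ℕ × ℕ × ℕ × ℕ) : e4 q 0 = q.1 ∧ e4 q 1 = q.2.1 ∧ e4 q 2 = q.2.2.1 ∧
      e4 q 3 = q.2.2.2 := by
    simp [e4]
  by_cases hlt : ∀ i, m i < 15
  · have hprod : ∀ q ∈ S19, ∏ i, sqCoeff (m i) (e4 q i) =
        if oddCoeff (m 3) q.2.2.2 ∧ oddCoeff (m 2) q.2.2.1 ∧ oddCoeff (m 1) q.2.1 ∧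
          oddCoeff (m 0) q.1 then 1 else 0 := by
      intro q hq
      obtain ⟨h₀, h₁, h₂, h₃⟩ := hS q hq
      rw [Fin.prod_univ_four, (he q).1, (he q).2.1, (he q).2.2.1, (he q).2.2.2,
        sqCoeff_eq_ite (hlt 0) h₀, sqCoeff_eq_ite (hlt 1) h₁, sqCoeff_eq_ite (hlt 2) h₂,
        sqCoeff_eq_ite (hlt 3) h₃]
      split_ifs <;> simp_all
    rw [Finset.sum_congr rfl hprod, Finset.sum_boole, Finset.card, Finset.filter_val, S19_val,
      Multiset.filter_coe, Multiset.coe_card, ZMod.natCast_eq_zero_iff_even, Nat.even_iff]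
    have hdeg : ¬ 33 ≤ m 0 + m 1 + m 2 + m 3 := by
      rw [Finsupp.degree_eq_sum, Fin.sum_univ_four] at hm
      lia
    have h := evenIncidence_eq_true
    simp only [evenIncidence, List.all_eq_true, List.mem_range, List.filter_filter,
      Bool.or_eq_true, Nat.ble_eq, List.isEmpty_iff] at h
    rcases h _ (hlt 0) _ (hlt 1) _ (hlt 2) with h | h
    · have hnil : quadruples.filter (fun q => oddCoeff (m 3) q.2.2.2 ∧ oddCoeff (m 2) q.2.2.1 ∧
          oddCoeff (m 1) q.2.1 ∧ oddCoeff (m 0) q.1) = [] := by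
        rw [List.filter_eq_nil_iff] at h ⊢
        intro q hq hqm
        exact h q hq (by simpa using (of_decide_eq_true hqm).2)
      rw [hnil, List.length_nil]
    · simpa using (h _ (hlt 3)).resolve_left hdeg
  · push Not at hlt
    obtain ⟨i, hi⟩ := hlt
    refine Finset.sum_eq_zero fun q hq => Finset.prod_eq_zero (Finset.mem_univ i) ?_
    refine sqCoeff_eq_zero_of_lt (lt_of_lt_of_le ?_ hi)
    have := hS q hq
    have := he q
    fin_cases i <;> simp_all

theorem lam4_apply (f : P 4) : lam4 f = ∑ q ∈ S19, coeff (e4 q) f := by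
  unfold lam4
  rw [LinearMap.coe_mk, AddHom.coe_mk]

theorem lam4_homogeneousComponent (n : ℕ) (f : P 4) :
    lam4 (homogeneousComponent n f) = if n = 33 then lam4 f else 0 := by
  have he : ∀ q ∈ S19, (e4 q).degree = 33 := by
    have h : ∀ q ∈ S19, q.1 + q.2.1 + q.2.2.1 + q.2.2.2 = 33 := by decide +kernel
    intro q hq
    simpa [e4] using h q hq
  rw [lam4_apply, lam4_apply]
  split_ifs with hn
  · refine Finset.sum_congr rfl fun q hq => ?_
    rw [coeff_homogeneousComponent, if_pos (by rw [he q hq, hn])]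
  · refine Finset.sum_eq_zero fun q hq => ?_
    rw [coeff_homogeneousComponent, if_neg (by rw [he q hq]; exact Ne.symm hn)]

theorem lam4_SqTotal_eq_zero {d : ℕ} (hd : d < 33) {f : P 4} (hf : f ∈ homSub 4 d) :
    lam4 (SqTotal 4 f) = 0 := by
  rw [f.as_sum, map_sum, map_sum]
  refine Finset.sum_eq_zero fun m hm => ?_
  have hdeg : m.degree = d := by
    rw [Finsupp.degree_eq_weight_one]
    exact hf (mem_support_iff.mp hm)
  rw [← mul_one (coeff m f), ← smul_eq_mul, ← smul_monomial, map_smul, map_smul]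
  have h : lam4 (SqTotal 4 (monomial m 1)) = ∑ q ∈ S19, ∏ i, sqCoeff (m i) (e4 q i) :=
    (lam4_apply _).trans <| Finset.sum_congr rfl fun q _ => coeff_SqTotal_monomial m (e4 q)
  rw [h, sum_prod_sqCoeff_eq_zero m (by lia), smul_zero]

theorem lam4_Sq_eq_zero {n : ℕ} (hn : 1 ≤ n) (g : P 4) : lam4 (Sq 4 n g) = 0 := by
  rw [Sq, map_sum]
  refine Finset.sum_eq_zero fun d _ => ?_
  rw [lam4_homogeneousComponent]
  split_ifs with h
  · exact lam4_SqTotal_eq_zero (by lia) (homogeneousComponent_mem d g)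
  · rfl

/-- Primitivity of the preimage of `p₀`: the functional `λ` vanishes on
`A⁺P_4 ∩ (P_4)_{33}`; equivalently `λ(Sq^i(g)) = 0` for every `i ≥ 1` and every
homogeneous `g` of degree `33 - i`. -/
theorem lam4_annihilates_hit :
    (∀ u : P 4, u ∈ hit 4 → u ∈ homSub 4 33 → lam4 u = 0) ∧
      (∀ i : ℕ, 1 ≤ i → ∀ g : P 4, g ∈ homSub 4 (33 - i) → lam4 (Sq 4 i g) = 0) := by
  refine ⟨fun u hu _ => ?_, fun i hi g _ => lam4_Sq_eq_zero hi g⟩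
  have h : hit 4 ≤ LinearMap.ker lam4 := by
    refine Submodule.span_le.mpr ?_
    rintro _ ⟨n, hn, g, rfl⟩
    exact lam4_Sq_eq_zero hn g
  exact h hu
end
end
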